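/- Let n = 4 and let ω = −dq²∧dq³∧dq⁴∧dp₁ + (1/3)(dq¹∧dq²∧dp₁∧dp₂ + dq³∧dq⁴∧dp₃∧dp₄) − (1/6)(dq¹∧dq³∧dp₁∧dp₃ + dq¹∧dq⁴∧dp₁∧dp₄ + dq²∧dq³∧dp₂∧dp₃ + dq²∧dq⁴∧dp₂∧dp₄) on ℝ⁹. Then: (i) ω is effective and (j¹φ)*ω = (φ₁₁ + φ₁₃φ₂₄ − φ₁₄φ₂₃)·β for every smooth φ: ℝ⁴ → ℝ, where φ_{μν} := ∂²φ/∂q^μ∂q^ν, so ω represents the Grant equation φ₁₁ + φ₂₄φ₁₃ − φ₂₃φ₁₄ = 0; and (ii) there exist no smooth function L: ℝ⁹ → ℝ and no nowhere-vanishing smooth function k: ℝ⁹ → ℝ such that k·ω = E(Lβ). Hence the Grant equation is not the Euler–Lagrange equation of any first-order Lagrangian. -/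

import Mathlib

noncomputable section

namespace MA

/-- Points / tangent vectors of ℝ^m. -/
abbrev Vec (m : ℕ) := Fin m → ℝ

/-- An (unbundled) differential `k`-form on ℝ^m : at each point it eats a
`k`-tuple of tangent vectors and returns a real number. -/
abbrev Form (m k : ℕ) := Vec m → (Fin k → Vec m) → ℝ

/-- `ω` is pointwise an alternating multilinear map, i.e. a genuine exterior form. -/
def IsForm {m k : ℕ} (ω : Form m k) : Prop :=
  ∀ x : Vec m, ∃ a : AlternatingMap ℝ (Vec m) ℝ (Fin k), ∀ v, ω x v = a v

/-- Smoothness of a differential form (smoothness of all coefficients). -/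
def SmoothForm {m k : ℕ} (ω : Form m k) : Prop :=
  ∀ v : Fin k → Vec m, ContDiff ℝ (⊤ : ℕ∞) fun x => ω x v

/-- Multiplication of a form by a scalar function. -/
def fsmul {m k : ℕ} (f : Vec m → ℝ) (ω : Form m k) : Form m k := fun x v => f x * ω x v

/-- Wedge (exterior) product of differential forms. -/
def wedge {m k l : ℕ} (ω : Form m k) (η : Form m l) : Form m (k + l) := fun x v =>
  ((k.factorial * l.factorial : ℕ) : ℝ)⁻¹ *
    ∑ σ : Equiv.Perm (Fin (k + l)),
      ((Equiv.Perm.sign σ : ℤ) : ℝ) *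
        (ω x fun i => v (σ (Fin.castAdd l i))) *
        (η x fun j => v (σ (Fin.natAdd k j)))

/-- Interior product (contraction) of a form with a (constant) vector. -/
def iprod {m : ℕ} (u : Vec m) : ∀ {k : ℕ}, Form m k → Form m (k - 1)
  | 0, _ => 0
  | _ + 1, ω => fun x v => ω x (Fin.cons u v)

/-- Exterior derivative of a differential form (coordinate formula). -/
def exd {m k : ℕ} (ω : Form m k) : Form m (k + 1) := fun x v =>
  ∑ i : Fin (k + 1),
    (-1 : ℝ) ^ (i : ℕ) * fderiv ℝ (fun y => ω y fun j => v (i.succAbove j)) x (v i)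

/-- Change the (propositionally equal) degree of a form. -/
def reindex {m k l : ℕ} (h : k = l) (ω : Form m k) : Form m l :=
  fun x v => ω x fun i => v (Fin.cast h i)

/-- Pullback of a differential form along a map. -/
def pullback {a b k : ℕ} (f : Vec a → Vec b) (ω : Form b k) : Form a k :=
  fun x v => ω (f x) fun i => fderiv ℝ f x (v i)

/-- `i`-th standard basis vector of ℝ^m. -/
def basisVec {m : ℕ} (i : Fin m) : Vec m := Pi.single i 1

/-- The coordinate 1-form `dx^i`. -/
def dx {m : ℕ} (i : Fin m) : Form m 1 := fun _ v => v 0 i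

/-- Partial derivative of a function in the `i`-th coordinate direction. -/
def pd {m : ℕ} (i : Fin m) (f : Vec m → ℝ) : Vec m → ℝ := fun x => fderiv ℝ f x (basisVec i)

/- Jet-space coordinates on J¹ℝⁿ = ℝ^{2n+1} : (q¹,…,qⁿ,u,p₁,…,pₙ). -/

/-- Index of the coordinate `q^μ`. -/
def qIdx {n : ℕ} (μ : Fin n) : Fin (2 * n + 1) := ⟨μ, by have := μ.isLt; omega⟩

/-- Index of the coordinate `u`. -/
def uIdx {n : ℕ} : Fin (2 * n + 1) := ⟨n, by omega⟩

/-- Index of the coordinate `p_μ`. -/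
def pIdx {n : ℕ} (μ : Fin n) : Fin (2 * n + 1) := ⟨n + 1 + μ, by have := μ.isLt; omega⟩

/-- The Reeb field `χ = ∂/∂u` (a constant vector field). -/
def chi {n : ℕ} : Vec (2 * n + 1) := basisVec uIdx

/-- The standard contact form `c = du - Σ p_μ dq^μ` on J¹ℝⁿ. -/
def contact {n : ℕ} : Form (2 * n + 1) 1 := fun x v =>
  v 0 uIdx - ∑ μ : Fin n, x (pIdx μ) * v 0 (qIdx μ)

/-- The symplectic-type 2-form `Ω = dc = Σ dq^μ ∧ dp_μ`. -/
def symp {n : ℕ} : Form (2 * n + 1) 2 := ∑ μ : Fin n, wedge (dx (qIdx μ)) (dx (pIdx μ))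

/-- The bottom operator `⊥ = Σ_μ ∂_{p_μ} ⌟ ∂_{q^μ} ⌟ ·` (zero on forms of degree ≤ 1). -/
def botOp {n k : ℕ} (ω : Form (2 * n + 1) k) : Form (2 * n + 1) (k - 2) :=
  ∑ μ : Fin n, iprod (basisVec (pIdx μ)) (iprod (basisVec (qIdx μ)) ω)

/-- A form is effective if it is killed by `χ ⌟ ·` and by `⊥`. -/
def Effective {n k : ℕ} (ω : Form (2 * n + 1) k) : Prop :=
  iprod (chi (n := n)) ω = 0 ∧ botOp ω = 0

/-- The projection `p(α) = α - c ∧ (χ ⌟ α)` onto forms annihilated by `χ ⌟ ·`. -/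
def proj {n : ℕ} : ∀ {k : ℕ}, Form (2 * n + 1) k → Form (2 * n + 1) k
  | 0, α => α
  | j + 1, α => α - reindex (Nat.add_comm 1 j) (wedge contact (iprod (chi (n := n)) α))

/-- The projected exterior derivative `d_p = p ∘ d`. -/
def dproj {n k : ℕ} (ω : Form (2 * n + 1) k) : Form (2 * n + 1) (k + 1) := proj (exd ω)

/-- Lie derivative along the (constant) Reeb field `χ`. -/
def lieChi {n k : ℕ} (ω : Form (2 * n + 1) k) : Form (2 * n + 1) k := fun x v =>
  fderiv ℝ (fun y => ω y v) x (chi (n := n))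

/-- The Euler operator `E = d_p ∘ ⊥ ∘ d_p + L_χ` on n-forms over J¹ℝⁿ. -/
def euler : ∀ {n : ℕ}, Form (2 * n + 1) n → Form (2 * n + 1) n
  | 0, ω => lieChi ω
  | n + 1, ω =>
    reindex (show n + 1 + 1 - 2 + 1 = n + 1 by omega) (dproj (botOp (dproj ω))) + lieChi ω

/-- The horizontal volume form `β = dq¹ ∧ … ∧ dqⁿ` on J¹ℝⁿ. -/
def qvol {n : ℕ} : Form (2 * n + 1) n := fun _ v =>
  Matrix.det (Matrix.of fun i j : Fin n => v i (qIdx j))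

/-- The volume form `β = dq¹ ∧ … ∧ dqⁿ` on the base ℝⁿ. -/
def baseVol {n : ℕ} : Form n n := fun _ v => Matrix.det (Matrix.of fun i j : Fin n => v i j)

/-- `β_μ = ∂_{q^μ} ⌟ β`. -/
def betaMu {n : ℕ} (μ : Fin n) : Form (2 * n + 1) (n - 1) := iprod (basisVec (qIdx μ)) qvol

/-- The first jet prolongation `j¹φ : ℝⁿ → ℝ^{2n+1}`, `x ↦ (x, φ(x), ∂₁φ(x), …, ∂ₙφ(x))`. -/
def jet {n : ℕ} (φ : Vec n → ℝ) (x : Vec n) : Vec (2 * n + 1) := fun i =>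
  if h : (i : ℕ) < n then x ⟨i, h⟩
  else if h2 : (i : ℕ) = n then φ x
  else fderiv ℝ φ x (basisVec ⟨(i : ℕ) - (n + 1), by have := i.isLt; omega⟩)

/-- Second partial derivative `φ_{μν} = ∂²φ/∂q^μ∂q^ν`. -/
def d2 {n : ℕ} (φ : Vec n → ℝ) (μ ν : Fin n) : Vec n → ℝ := fun x =>
  fderiv ℝ (fun y => fderiv ℝ φ y (basisVec ν)) x (basisVec μ)

/-- A form is multisymplectic if it is closed and pointwise nondegenerate. -/
def Multisymplectic {m k : ℕ} (μ : Form m k) : Prop :=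
  exd μ = 0 ∧ ∀ (x v : Vec m), iprod v μ x = 0 → v = 0

/-- Lift a form on J¹ℝⁿ = ℝ^{2n+1} to ℝ^{2n+2} = J¹ℝⁿ × ℝ (extra coordinate `e`)
along the projection. -/
def liftForm {n k : ℕ} (ω : Form (2 * n + 1) k) : Form (2 * n + 1 + 1) k :=
  pullback (fun y (i : Fin (2 * n + 1)) => y i.castSucc) ω

/-- The 1-form `de` on ℝ^{2n+2}. -/
def deForm {n : ℕ} : Form (2 * n + 1 + 1) 1 := dx (Fin.last (2 * n + 1))

/-- The (n+1)-form `m_ω = de ∧ β + c ∧ ω` on ℝ^{2n+2}. -/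
def msf {n : ℕ} (ω : Form (2 * n + 1) n) : Form (2 * n + 1 + 1) (n + 1) :=
  reindex (Nat.add_comm 1 n) (wedge (deForm (n := n)) (liftForm qvol)) +
    reindex (Nat.add_comm 1 n) (wedge (liftForm (contact (n := n))) (liftForm ω))

/-- Wedge of four coordinate 1-forms on ℝ⁹ = J¹ℝ⁴. -/
def dd (i j k l : Fin (2 * 4 + 1)) : Form (2 * 4 + 1) 4 :=
  wedge (wedge (wedge (dx i) (dx j)) (dx k)) (dx l)

/-- The effective 4-form on ℝ⁹ representing the Grant equation. -/
def omegaG : Form (2 * 4 + 1) 4 :=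
  -(dd (qIdx 1) (qIdx 2) (qIdx 3) (pIdx 0)) +
    (1 / 3 : ℝ) • (dd (qIdx 0) (qIdx 1) (pIdx 0) (pIdx 1) +
      dd (qIdx 2) (qIdx 3) (pIdx 2) (pIdx 3)) -
    (1 / 6 : ℝ) • (dd (qIdx 0) (qIdx 2) (pIdx 0) (pIdx 2) +
      dd (qIdx 0) (qIdx 3) (pIdx 0) (pIdx 3) +
      dd (qIdx 1) (qIdx 2) (pIdx 1) (pIdx 2) +
      dd (qIdx 1) (qIdx 3) (pIdx 1) (pIdx 3))

/-- The minor of a tuple of vectors cut out by the coordinates `f`, as a constant form. -/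
def minor {m k : ℕ} (f : Fin k → Fin m) : Form m k := fun _ v =>
  Matrix.det (Matrix.of fun a b : Fin k => v a (f b))

lemma dx_eq_minor {m : ℕ} (i : Fin m) : dx i = minor ![i] := by
  funext x v
  simp [dx, minor]

lemma wedge_minor_dx {m k : ℕ} (f : Fin k → Fin m) (l : Fin m) :
    wedge (minor f) (dx l) = minor (Fin.append f ![l]) := by
  funext x v
  have key : ∀ τ : Equiv.Perm (Fin k),
      ∑ σ : Equiv.Perm (Fin (k + 1)), ((Equiv.Perm.sign σ : ℤ) : ℝ) *
        (((Equiv.Perm.sign τ : ℤ) : ℝ) * ∏ i, v (σ (Fin.castAdd 1 (τ i))) (f i)) *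
          v (σ (Fin.natAdd k 0)) l = minor (Fin.append f ![l]) x v := by
    intro τ
    let τ' : Equiv.Perm (Fin (k + 1)) :=
      finSumFinEquiv.permCongr (Equiv.Perm.sumCongr τ (1 : Equiv.Perm (Fin 1)))
    have hsign : Equiv.Perm.sign τ' = Equiv.Perm.sign τ := by
      simp [τ', Equiv.Perm.sign_permCongr, Equiv.Perm.sign_sumCongr]
    have hl : ∀ i, τ' (Fin.castAdd 1 i) = Fin.castAdd 1 (τ i) := by
      intro i
      simp [τ', Equiv.permCongr_apply]
    have hr : τ' (Fin.natAdd k 0) = Fin.natAdd k (0 : Fin 1) := by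
      simp only [τ', Equiv.permCongr_apply, finSumFinEquiv_symm_apply_natAdd]
      simp
    conv_rhs => rw [minor, Matrix.det_apply, ← Equiv.sum_comp (Equiv.mulRight τ')]
    refine Finset.sum_congr rfl fun σ _ => ?_
    rw [Fin.prod_univ_add]
    simp only [Equiv.coe_mulRight, Equiv.Perm.sign_mul, hsign, Equiv.Perm.mul_apply, hl, hr,
      Matrix.of_apply, Fin.append_left, Fin.append_right, Fin.prod_univ_one, Units.smul_def,
      zsmul_eq_mul, Matrix.cons_val_zero, Units.val_mul, Int.cast_mul]
    ring
  have hk : ((k.factorial : ℕ) : ℝ) ≠ 0 := by exact_mod_cast k.factorial_ne_zero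
  simp only [wedge, dx]
  rw [inv_mul_eq_iff_eq_mul₀ (by simpa using hk)]
  conv_lhs =>
    enter [2, σ]
    rw [minor, Matrix.det_apply, Finset.mul_sum, Finset.sum_mul]
  rw [Finset.sum_comm]
  simp only [Units.smul_def, zsmul_eq_mul, Matrix.of_apply]
  simp only [key]
  simp [Fintype.card_perm]

lemma dd_eq_minor (i j k l : Fin (2 * 4 + 1)) : dd i j k l = minor ![i, j, k, l] := by
  have h : Fin.append (Fin.append (Fin.append ![i] ![j]) ![k]) ![l] = ![i, j, k, l] := by
    funext a
    fin_cases a <;> rfl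
  rw [dd, dx_eq_minor i, wedge_minor_dx, wedge_minor_dx, wedge_minor_dx, h]

lemma minor_cons_eq_zero {m k : ℕ} (f : Fin (k + 1) → Fin m) (i : Fin m) (hi : ∀ a, f a ≠ i)
    (x : Vec m) (v : Fin k → Vec m) : minor f x (Fin.cons (basisVec i) v) = 0 :=
  Matrix.det_eq_zero_of_row_eq_zero 0 fun a => by simp [basisVec, Pi.single_eq_of_ne (hi a)]

lemma omegaG_apply (x : Vec (2 * 4 + 1)) (v : Fin 4 → Vec (2 * 4 + 1)) :
    omegaG x v = -minor ![qIdx 1, qIdx 2, qIdx 3, pIdx 0] x v +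
      1 / 3 * (minor ![qIdx 0, qIdx 1, pIdx 0, pIdx 1] x v +
        minor ![qIdx 2, qIdx 3, pIdx 2, pIdx 3] x v) -
      1 / 6 * (minor ![qIdx 0, qIdx 2, pIdx 0, pIdx 2] x v +
        minor ![qIdx 0, qIdx 3, pIdx 0, pIdx 3] x v +
        minor ![qIdx 1, qIdx 2, pIdx 1, pIdx 2] x v +
        minor ![qIdx 1, qIdx 3, pIdx 1, pIdx 3] x v) := by
  simp only [omegaG, dd_eq_minor]
  rfl

lemma qIdx_injective {n : ℕ} : Function.Injective (qIdx (n := n)) := fun μ ν h =>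
  Fin.ext (by simpa [qIdx] using h)

lemma pIdx_injective {n : ℕ} : Function.Injective (pIdx (n := n)) := fun μ ν h =>
  Fin.ext (by simpa [pIdx] using h)

lemma qIdx_ne_pIdx {n : ℕ} (μ ν : Fin n) : qIdx μ ≠ pIdx ν := fun h => by
  have := congrArg Fin.val h
  simp only [qIdx, pIdx] at this
  omega

lemma qIdx_ne_uIdx {n : ℕ} (μ : Fin n) : qIdx μ ≠ uIdx := fun h => by
  have := congrArg Fin.val h
  simp only [qIdx, uIdx] at this
  omega

lemma pIdx_ne_uIdx {n : ℕ} (μ : Fin n) : pIdx μ ≠ uIdx := fun h => by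
  have := congrArg Fin.val h
  simp only [pIdx, uIdx] at this
  omega

lemma basisVec_qIdx_qIdx {n : ℕ} (μ ν : Fin n) :
    (basisVec (qIdx μ) : Vec (2 * n + 1)) (qIdx ν) = if ν = μ then 1 else 0 := by
  simp [basisVec, Pi.single_apply, qIdx_injective.eq_iff]

lemma basisVec_pIdx_pIdx {n : ℕ} (μ ν : Fin n) :
    (basisVec (pIdx μ) : Vec (2 * n + 1)) (pIdx ν) = if ν = μ then 1 else 0 := by
  simp [basisVec, Pi.single_apply, pIdx_injective.eq_iff]

lemma basisVec_qIdx_pIdx {n : ℕ} (μ ν : Fin n) :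
    (basisVec (qIdx μ) : Vec (2 * n + 1)) (pIdx ν) = 0 :=
  Pi.single_eq_of_ne (qIdx_ne_pIdx μ ν).symm _

lemma basisVec_pIdx_qIdx {n : ℕ} (μ ν : Fin n) :
    (basisVec (pIdx μ) : Vec (2 * n + 1)) (qIdx ν) = 0 :=
  Pi.single_eq_of_ne (qIdx_ne_pIdx ν μ) _

lemma chi_qIdx {n : ℕ} (μ : Fin n) : (chi (n := n)) (qIdx μ) = 0 :=
  Pi.single_eq_of_ne (qIdx_ne_uIdx μ) _

lemma basisVec_qIdx_uIdx {n : ℕ} (μ : Fin n) : (basisVec (qIdx μ) : Vec (2 * n + 1)) uIdx = 0 :=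
  Pi.single_eq_of_ne (qIdx_ne_uIdx μ).symm _

lemma basisVec_pIdx_uIdx {n : ℕ} (μ : Fin n) : (basisVec (pIdx μ) : Vec (2 * n + 1)) uIdx = 0 :=
  Pi.single_eq_of_ne (pIdx_ne_uIdx μ).symm _

lemma det_fin_four (A : Matrix (Fin 4) (Fin 4) ℝ) :
    A.det =
      A 0 0 * (A 1 1 * (A 2 2 * A 3 3 - A 2 3 * A 3 2) - A 1 2 * (A 2 1 * A 3 3 - A 2 3 * A 3 1)
        + A 1 3 * (A 2 1 * A 3 2 - A 2 2 * A 3 1)) -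
      A 0 1 * (A 1 0 * (A 2 2 * A 3 3 - A 2 3 * A 3 2) - A 1 2 * (A 2 0 * A 3 3 - A 2 3 * A 3 0)
        + A 1 3 * (A 2 0 * A 3 2 - A 2 2 * A 3 0)) +
      A 0 2 * (A 1 0 * (A 2 1 * A 3 3 - A 2 3 * A 3 1) - A 1 1 * (A 2 0 * A 3 3 - A 2 3 * A 3 0)
        + A 1 3 * (A 2 0 * A 3 1 - A 2 1 * A 3 0)) -
      A 0 3 * (A 1 0 * (A 2 1 * A 3 2 - A 2 2 * A 3 1) - A 1 1 * (A 2 0 * A 3 2 - A 2 2 * A 3 0)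
        + A 1 2 * (A 2 0 * A 3 1 - A 2 1 * A 3 0)) := by
  rw [Matrix.det_succ_row_zero]
  simp [Fin.sum_univ_succ, Matrix.det_fin_three, Matrix.submatrix_apply, Fin.succAbove]
  ring

lemma minor_four {m : ℕ} (i j k l : Fin m) (x : Vec m) (v : Fin 4 → Vec m) :
    minor ![i, j, k, l] x v =
      v 0 i * (v 1 j * (v 2 k * v 3 l - v 2 l * v 3 k) - v 1 k * (v 2 j * v 3 l - v 2 l * v 3 j)
        + v 1 l * (v 2 j * v 3 k - v 2 k * v 3 j)) -
      v 0 j * (v 1 i * (v 2 k * v 3 l - v 2 l * v 3 k) - v 1 k * (v 2 i * v 3 l - v 2 l * v 3 i)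
        + v 1 l * (v 2 i * v 3 k - v 2 k * v 3 i)) +
      v 0 k * (v 1 i * (v 2 j * v 3 l - v 2 l * v 3 j) - v 1 j * (v 2 i * v 3 l - v 2 l * v 3 i)
        + v 1 l * (v 2 i * v 3 j - v 2 j * v 3 i)) -
      v 0 l * (v 1 i * (v 2 j * v 3 k - v 2 k * v 3 j) - v 1 j * (v 2 i * v 3 k - v 2 k * v 3 i)
        + v 1 k * (v 2 i * v 3 j - v 2 j * v 3 i)) := by
  rw [minor, det_fin_four]
  rfl

lemma effective_omegaG : Effective omegaG := by
  constructor
  · funext x v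
    change omegaG x (Fin.cons (basisVec uIdx) v) = 0
    rw [omegaG_apply]
    repeat rw [minor_cons_eq_zero]
    · simp
    all_goals
      intro a
      fin_cases a <;> first | exact qIdx_ne_uIdx _ | exact pIdx_ne_uIdx _
  · funext x v
    have hsum : botOp omegaG x v = ∑ μ : Fin 4, omegaG x
        (Fin.cons (basisVec (qIdx μ)) (Fin.cons (basisVec (pIdx μ)) v)) := by
      simp only [botOp, Finset.sum_apply]
      rfl
    rw [hsum]
    have h0 (a b : Vec (2 * 4 + 1)) (w : Fin 2 → Vec (2 * 4 + 1)) :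
        (Fin.cons a (Fin.cons b w : Fin 3 → Vec (2 * 4 + 1)) : Fin 4 → Vec (2 * 4 + 1)) =
          ![a, b, w 0, w 1] := by
      funext i
      fin_cases i <;> rfl
    have h1 (μ : Fin 4) := h0 (basisVec (qIdx μ)) (basisVec (pIdx μ)) v
    simp only [Fin.sum_univ_four]
    erw [h1 0, h1 1, h1 2, h1 3]
    simp only [omegaG_apply, minor_four, Matrix.cons_val, basisVec_qIdx_qIdx, basisVec_pIdx_pIdx,
      basisVec_qIdx_pIdx, basisVec_pIdx_qIdx]
    simp
    ring

lemma jet_qIdx {n : ℕ} (φ : Vec n → ℝ) (x : Vec n) (μ : Fin n) : jet φ x (qIdx μ) = x μ := by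
  simp [jet, qIdx]

lemma jet_pIdx {n : ℕ} (φ : Vec n → ℝ) (x : Vec n) (μ : Fin n) :
    jet φ x (pIdx μ) = fderiv ℝ φ x (basisVec μ) := by
  have h : ¬ n + 1 + (μ : ℕ) < n := by omega
  have h' : ¬ n + 1 + (μ : ℕ) = n := by omega
  simp [jet, pIdx, h, h']

lemma differentiable_fderiv_apply {n : ℕ} {φ : Vec n → ℝ} (hφ : ContDiff ℝ (⊤ : ℕ∞) φ)
    (w : Vec n) : Differentiable ℝ fun y => fderiv ℝ φ y w :=
  ((hφ.fderiv_right (m := 1) (by norm_cast)).differentiable (by norm_num)).clm_apply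
    (differentiable_const w)

lemma differentiable_jet {n : ℕ} {φ : Vec n → ℝ} (hφ : ContDiff ℝ (⊤ : ℕ∞) φ) :
    Differentiable ℝ (jet φ) := by
  rw [differentiable_pi]
  intro i
  unfold jet
  split_ifs
  · exact differentiable_apply _
  · exact hφ.differentiable (by simp)
  · exact differentiable_fderiv_apply hφ _

lemma fderiv_jet_qIdx {n : ℕ} {φ : Vec n → ℝ} (hφ : ContDiff ℝ (⊤ : ℕ∞) φ) (x : Vec n)
    (ν μ : Fin n) : fderiv ℝ (jet φ) x (basisVec ν) (qIdx μ) = if μ = ν then 1 else 0 := by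
  have h := DFunLike.congr_fun (fderiv_apply (differentiable_jet hφ x) (qIdx μ)) (basisVec ν)
  simp only [jet_qIdx] at h
  refine h.symm.trans ?_
  rw [(hasFDerivAt_apply μ x).fderiv]
  simp [basisVec, Pi.single_apply]

lemma fderiv_jet_pIdx {n : ℕ} {φ : Vec n → ℝ} (hφ : ContDiff ℝ (⊤ : ℕ∞) φ) (x : Vec n)
    (ν μ : Fin n) : fderiv ℝ (jet φ) x (basisVec ν) (pIdx μ) = d2 φ ν μ x := by
  have h := DFunLike.congr_fun (fderiv_apply (differentiable_jet hφ x) (pIdx μ)) (basisVec ν)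
  simp only [jet_pIdx] at h
  refine h.symm.trans ?_
  rfl

lemma d2_symm {n : ℕ} {φ : Vec n → ℝ} (hφ : ContDiff ℝ (⊤ : ℕ∞) φ) (x : Vec n) (μ ν : Fin n) :
    d2 φ μ ν x = d2 φ ν μ x := by
  have hd : DifferentiableAt ℝ (fderiv ℝ φ) x :=
    (hφ.fderiv_right (m := 1) (by norm_cast)).differentiable (by norm_num) x
  have h (a b : Fin n) : d2 φ a b x = fderiv ℝ (fderiv ℝ φ) x (basisVec a) (basisVec b) := by
    rw [d2, fderiv_clm_apply hd (differentiableAt_const _)]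
    simp
  rw [h, h]
  exact (hφ.contDiffAt.isSymmSndFDerivAt (by simp; norm_cast)).eq _ _

/-- A linear pullback multiplies a minor by the determinant of the vectors it is applied to. -/
lemma minor_linear {a b : ℕ} (T : Vec a →L[ℝ] Vec b) (f : Fin a → Fin b) (x : Vec b) (y : Vec a)
    (v : Fin a → Vec a) :
    minor f x (fun i => T (v i)) = minor f x (fun i => T (basisVec i)) * baseVol y v := by
  rw [mul_comm, minor, minor, baseVol, ← Matrix.det_mul]
  congr 1
  ext i j
  have h : v i = ∑ ν, v i ν • (basisVec ν : Vec a) := by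
    simpa [basisVec] using pi_eq_sum_univ' (v i)
  conv_lhs => rw [Matrix.of_apply, h, map_sum]
  simp [Matrix.mul_apply]

lemma pullback_jet_omegaG {φ : Vec 4 → ℝ} (hφ : ContDiff ℝ (⊤ : ℕ∞) φ) :
    pullback (jet φ) omegaG = fsmul (fun x => d2 φ 0 0 x + d2 φ 0 2 x * d2 φ 1 3 x -
      d2 φ 0 3 x * d2 φ 1 2 x) baseVol := by
  funext x v
  simp only [pullback, fsmul, omegaG_apply]
  simp only [minor_linear _ _ _ x v]
  simp only [minor_four, fderiv_jet_qIdx hφ, fderiv_jet_pIdx hφ]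
  simp only [d2_symm hφ x 1 0, d2_symm hφ x 2 0, d2_symm hφ x 3 0, d2_symm hφ x 2 1,
    d2_symm hφ x 3 1, d2_symm hφ x 3 2]
  simp
  ring

/-- A vector is vertical if all its `q`-components vanish. -/
def Vertical {n : ℕ} (w : Vec (2 * n + 1)) : Prop := ∀ μ : Fin n, w (qIdx μ) = 0

lemma vertical_chi {n : ℕ} : Vertical (chi (n := n)) := chi_qIdx

lemma vertical_basisVec_pIdx {n : ℕ} (μ : Fin n) : Vertical (basisVec (pIdx μ)) :=
  basisVec_pIdx_qIdx μ

lemma fsmul_qvol_eq_zero {n : ℕ} (L : Vec (2 * n + 1) → ℝ) (y : Vec (2 * n + 1))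
    {v : Fin n → Vec (2 * n + 1)} {i : Fin n} (hi : Vertical (v i)) : fsmul L qvol y v = 0 := by
  exact mul_eq_zero_of_right _ (Matrix.det_eq_zero_of_row_eq_zero i hi)

lemma exd_fsmul_qvol_eq_zero {n : ℕ} (L : Vec (2 * n + 1) → ℝ) (y : Vec (2 * n + 1))
    {v : Fin (n + 1) → Vec (2 * n + 1)} {i j : Fin (n + 1)} (hij : i ≠ j)
    (hi : Vertical (v i)) (hj : Vertical (v j)) : exd (fsmul L qvol) y v = 0 := by
  refine Finset.sum_eq_zero fun l _ => ?_
  have hz : (fun z => fsmul L qvol z fun a => v (l.succAbove a)) = fun _ => 0 := by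
    funext z
    by_cases hl : i = l
    · obtain ⟨a, rfl⟩ := Fin.exists_succAbove_eq (show j ≠ l from fun h => hij (hl.trans h.symm))
      exact fsmul_qvol_eq_zero L z (i := a) hj
    · obtain ⟨a, rfl⟩ := Fin.exists_succAbove_eq hl
      exact fsmul_qvol_eq_zero L z (i := a) hi
  rw [hz]
  simp

lemma dproj_fsmul_qvol_eq_zero {n : ℕ} (L : Vec (2 * n + 1) → ℝ) (y : Vec (2 * n + 1))
    {v : Fin (n + 1) → Vec (2 * n + 1)} {i j : Fin (n + 1)} (hij : i ≠ j)
    (hi : Vertical (v i)) (hj : Vertical (v j)) : dproj (fsmul L qvol) y v = 0 := by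
  have hw : reindex (Nat.add_comm 1 n)
      (wedge contact (iprod (chi (n := n)) (exd (fsmul L qvol)))) y v = 0 := by
    rw [reindex, wedge, Finset.sum_eq_zero, mul_zero]
    intro σ _
    refine mul_eq_zero_of_right _ ?_
    have key (l : Fin (n + 1)) (hl : Vertical (v l))
        (hσ : σ (Fin.castAdd n 0) ≠ Fin.cast (Nat.add_comm n 1) l) :
        iprod (chi (n := n)) (exd (fsmul L qvol)) y
          (fun a => v (Fin.cast (Nat.add_comm 1 n) (σ (Fin.natAdd 1 a)))) = 0 := by
      obtain ⟨b, hb⟩ := σ.surjective (Fin.cast (Nat.add_comm n 1) l)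
      induction b using Fin.addCases with
      | left b => exact absurd (by rw [← hb, Subsingleton.elim b 0]) hσ
      | right b =>
        refine exd_fsmul_qvol_eq_zero L y (i := 0) (j := b.succ) (Fin.succ_ne_zero b).symm
          vertical_chi ?_
        rw [Fin.cons_succ, hb]
        exact hl
    by_cases h : σ (Fin.castAdd n 0) = Fin.cast (Nat.add_comm n 1) i
    · refine key j hj fun h' => hij ?_
      simpa using h.symm.trans h'
    · exact key i hi h
  change exd (fsmul L qvol) y v - _ = 0
  rw [hw, exd_fsmul_qvol_eq_zero L y hij hi hj, sub_zero]

lemma botOp_dproj_fsmul_qvol_eq_zero {n : ℕ} (L : Vec (2 * (n + 1) + 1) → ℝ)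
    (y : Vec (2 * (n + 1) + 1)) {v : Fin n → Vec (2 * (n + 1) + 1)} {i : Fin n}
    (hi : Vertical (v i)) : botOp (dproj (fsmul L qvol)) y v = 0 := by
  have hsum : botOp (dproj (fsmul L qvol)) y v = ∑ μ : Fin (n + 1), dproj (fsmul L qvol) y
      (Fin.cons (basisVec (qIdx μ)) (Fin.cons (basisVec (pIdx μ)) v)) := by
    simp only [botOp, Finset.sum_apply]
    rfl
  rw [hsum]
  refine Finset.sum_eq_zero fun μ _ => ?_
  exact dproj_fsmul_qvol_eq_zero L y (i := (0 : Fin (n + 1)).succ) (j := i.succ.succ)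
    (fun h => (Fin.succ_ne_zero i (Fin.succ_injective _ h).symm).elim)
    (vertical_basisVec_pIdx μ) hi

/-- Euler–Lagrange forms of first-order Lagrangians contain no terms quadratic in the `dp`. -/
lemma euler_fsmul_qvol_eq_zero {n : ℕ} (L : Vec (2 * (n + 1) + 1) → ℝ)
    {x : Vec (2 * (n + 1) + 1)} {v : Fin (n + 1) → Vec (2 * (n + 1) + 1)}
    {i j : Fin (n + 1)} (hij : i ≠ j) (hi : Vertical (v i)) (hj : Vertical (v j))
    (hc : ∀ l, contact x (fun _ => v l) = 0) : euler (fsmul L qvol) x v = 0 := by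
  have hlie : lieChi (fsmul L qvol) x v = 0 := by
    have : (fun y => fsmul L qvol y v) = fun _ => 0 :=
      funext fun y => fsmul_qvol_eq_zero L y hi
    rw [lieChi, this]
    simp
  have hexd : exd (botOp (dproj (fsmul L qvol))) x v = 0 := by
    refine Finset.sum_eq_zero fun l _ => ?_
    have hz : (fun z => botOp (dproj (fsmul L qvol)) z fun a => v (l.succAbove a)) =
        fun _ => 0 := by
      funext z
      by_cases hl : i = l
      · obtain ⟨a, rfl⟩ := Fin.exists_succAbove_eq (show j ≠ l from fun h => hij (hl.trans h.symm))
        exact botOp_dproj_fsmul_qvol_eq_zero L z (i := a) hj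
      · obtain ⟨a, rfl⟩ := Fin.exists_succAbove_eq hl
        exact botOp_dproj_fsmul_qvol_eq_zero L z (i := a) hi
    erw [hz]
    simp
  have hw : reindex (Nat.add_comm 1 n) (wedge contact
      (iprod (chi (n := n + 1)) (exd (botOp (dproj (fsmul L qvol)))))) x v = 0 := by
    rw [reindex, wedge, Finset.sum_eq_zero, mul_zero]
    intro σ _
    refine mul_eq_zero_of_left (mul_eq_zero_of_right _ ?_) _
    exact hc _
  have hd : dproj (botOp (dproj (fsmul L qvol))) x v = 0 := by
    change exd (botOp (dproj (fsmul L qvol))) x v - _ = 0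
    rw [hexd, zero_sub, neg_eq_zero]
    exact hw
  change dproj (botOp (dproj (fsmul L qvol))) x v + lieChi (fsmul L qvol) x v = 0
  rw [hd, hlie, add_zero]

lemma contact_zero {n : ℕ} {w : Vec (2 * n + 1)} (hw : w uIdx = 0) :
    contact 0 (fun _ => w) = 0 := by
  simp [contact, hw]

/-- the displayed effective 4-form represents the Grant equation
`φ₁₁ + φ₂₄φ₁₃ − φ₂₃φ₁₄ = 0`, and this equation is not the Euler–Lagrange equation of any
first-order Lagrangian. -/
theorem grant_equation_not_variational :
    (Effective omegaG ∧
      ∀ φ : Vec 4 → ℝ, ContDiff ℝ (⊤ : ℕ∞) φ →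
        pullback (jet φ) omegaG =
          fsmul (fun x => d2 φ 0 0 x + d2 φ 0 2 x * d2 φ 1 3 x -
            d2 φ 0 3 x * d2 φ 1 2 x) baseVol) ∧
    ¬ ∃ (L k : Vec (2 * 4 + 1) → ℝ), ContDiff ℝ (⊤ : ℕ∞) L ∧ ContDiff ℝ (⊤ : ℕ∞) k ∧ (∀ x, k x ≠ 0) ∧
        fsmul k omegaG = euler (fsmul L qvol) := by
  refine ⟨⟨effective_omegaG, fun φ hφ => pullback_jet_omegaG hφ⟩, ?_⟩
  rintro ⟨L, k, -, -, hk, h⟩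
  let v : Fin 4 → Vec (2 * 4 + 1) :=
    ![basisVec (qIdx 0), basisVec (qIdx 1), basisVec (pIdx 0), basisVec (pIdx 1)]
  have hE : euler (fsmul L qvol) 0 v = 0 := by
    refine euler_fsmul_qvol_eq_zero L (i := 2) (j := 3) (by decide) (vertical_basisVec_pIdx 0)
      (vertical_basisVec_pIdx 1) fun l => contact_zero ?_
    fin_cases l
    · exact basisVec_qIdx_uIdx (n := 4) 0
    · exact basisVec_qIdx_uIdx (n := 4) 1
    · exact basisVec_pIdx_uIdx (n := 4) 0
    · exact basisVec_pIdx_uIdx (n := 4) 1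
  have hω : omegaG 0 v = 1 / 3 := by
    simp only [omegaG_apply, minor_four, v, Matrix.cons_val, basisVec_qIdx_qIdx,
      basisVec_pIdx_pIdx, basisVec_qIdx_pIdx, basisVec_pIdx_qIdx]
    simp
  have h0 : k 0 * omegaG 0 v = 0 := (congrFun (congrFun h 0) v).trans hE
  rw [hω] at h0
  exact hk 0 (by linarith)

end MA
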